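/- Let X be a Bernoulli random variable with P(X = 0) = p₀ and P(X = 1) = 1 − p₀, let G be standard Gaussian independent of X, and let γ > 0, τ > 0. Then E[ |prox_{γ|·|}(X + τG)| ] = p₀ · 2τ ∫_{γ/τ}^{∞} (g − γ/τ) p_G(g) dg + (1 − p₀) · τ ( ∫_{γ/τ − 1/τ}^{∞} (g − γ/τ + 1/τ) p_G(g) dg − ∫_{−∞}^{−γ/τ − 1/τ} (g + γ/τ + 1/τ) p_G(g) dg ). -/

import Mathlib

open MeasureTheory ProbabilityTheory
open scoped ENNReal

/-- Standard Gaussian probability density function. -/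
noncomputable def pG (t : ℝ) : ℝ := (Real.sqrt (2 * Real.pi))⁻¹ * Real.exp (-t ^ 2 / 2)

/-- Soft thresholding: the proximity operator of `γ` times the absolute value,
`prox_{γ|·|}(q) = sign(q)·max(|q| − γ, 0)`. -/
noncomputable def softThresh (γ q : ℝ) : ℝ := Real.sign q * max (|q| - γ) 0

/-- The Bernoulli distribution on `ℝ` with `P(X = 0) = p₀`, `P(X = 1) = 1 − p₀`. -/
noncomputable def bernoulliOnReal (p₀ : ℝ) : Measure ℝ :=
  ENNReal.ofReal p₀ • Measure.dirac (0 : ℝ)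
    + ENNReal.ofReal (1 - p₀) • Measure.dirac (1 : ℝ)

lemma integrable_add_const_mul_pG (c : ℝ) : Integrable fun g => (g + c) * pG g := by
  have h₁ := integrable_mul_exp_neg_mul_sq (b := 1 / 2) (by norm_num)
  have h₂ := integrable_exp_neg_mul_sq (b := 1 / 2) (by norm_num)
  refine ((h₁.add (h₂.const_mul c)).const_mul (Real.sqrt (2 * Real.pi))⁻¹).congr
    (Filter.Eventually.of_forall fun g => ?_)
  have h : -g ^ 2 / 2 = -(1 / 2) * g ^ 2 := by ring
  simp only [pG, Pi.add_apply, h]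
  ring

lemma integral_gaussianReal_eq_integral_mul_pG (f : ℝ → ℝ) :
    ∫ g, f g ∂(gaussianReal 0 1) = ∫ g, f g * pG g := by
  rw [integral_gaussianReal_eq_integral_smul one_ne_zero]
  refine integral_congr_ae (Filter.Eventually.of_forall fun g => ?_)
  simp [gaussianPDFReal, pG, mul_comm]

lemma abs_softThresh {γ : ℝ} (hγ : 0 < γ) (q : ℝ) :
    |softThresh γ q| = max (|q| - γ) 0 := by
  rcases lt_trichotomy q 0 with h | rfl | h
  · simp [softThresh, Real.sign_of_neg h]
  · simp [softThresh, hγ.le]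
  · simp [softThresh, Real.sign_of_pos h]

lemma abs_softThresh_add_mul {γ τ : ℝ} (hγ : 0 < γ) (hτ : 0 < τ) (x g : ℝ) :
    |softThresh γ (x + τ * g)| * pG g
      = τ * ((Set.Ioi (γ / τ - x / τ)).indicator (fun g => (g - γ / τ + x / τ) * pG g) g
        - (Set.Iic (-(γ / τ) - x / τ)).indicator (fun g => (g + γ / τ + x / τ) * pG g) g) := by
  have hxg : x + τ * g = τ * (g + x / τ) := by field_simp; ring
  have hγτ : γ = τ * (γ / τ) := by field_simp
  have hc : 0 < γ / τ := div_pos hγ hτ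
  rw [abs_softThresh hγ, hxg, abs_mul, abs_of_pos hτ]
  generalize γ / τ = c at *
  generalize x / τ = y at *
  subst hγτ
  rw [← mul_sub, ← mul_zero τ, ← mul_max_of_nonneg _ _ hτ.le, mul_assoc]
  congr 1
  simp only [Set.indicator_apply, Set.mem_Ioi, Set.mem_Iic]
  split_ifs with h₁ h₂ h₂
  · linarith
  · rw [abs_of_pos (by linarith), max_eq_left (by linarith)]
    ring
  · rw [abs_of_neg (by linarith), max_eq_left (by linarith)]
    ring
  · rw [max_eq_right]
    · ring
    · rw [sub_nonpos, abs_le]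
      constructor <;> linarith

lemma integral_abs_softThresh {γ τ : ℝ} (hγ : 0 < γ) (hτ : 0 < τ) (x : ℝ) :
    ∫ g, |softThresh γ (x + τ * g)| ∂(gaussianReal 0 1)
      = τ * ((∫ g in Set.Ioi (γ / τ - x / τ), (g - γ / τ + x / τ) * pG g)
        - ∫ g in Set.Iic (-(γ / τ) - x / τ), (g + γ / τ + x / τ) * pG g) := by
  have h₁ : Integrable fun g => (g - γ / τ + x / τ) * pG g := by
    simpa only [sub_eq_add_neg, add_assoc] using
      integrable_add_const_mul_pG (-(γ / τ) + x / τ)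
  have h₂ : Integrable fun g => (g + γ / τ + x / τ) * pG g := by
    simpa only [add_assoc] using integrable_add_const_mul_pG (γ / τ + x / τ)
  simp_rw [integral_gaussianReal_eq_integral_mul_pG, abs_softThresh_add_mul hγ hτ]
  rw [integral_const_mul, integral_sub (h₁.indicator measurableSet_Ioi)
    (h₂.indicator measurableSet_Iic), integral_indicator measurableSet_Ioi,
    integral_indicator measurableSet_Iic]

lemma integral_Iic_neg_add_mul_pG (c : ℝ) :
    ∫ g in Set.Iic (-c), (g + c) * pG g = -∫ g in Set.Ioi c, (g - c) * pG g := by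
  have h := integral_comp_neg_Iic (-c) fun g => (g - c) * pG g
  rw [neg_neg] at h
  rw [← h, ← integral_neg]
  congr 1 with g
  simp only [pG, neg_sq]
  ring

lemma integral_bernoulliOnReal {p₀ : ℝ} (hp₀ : 0 ≤ p₀) (hp₁ : p₀ ≤ 1) (f : ℝ → ℝ) :
    ∫ x, f x ∂(bernoulliOnReal p₀) = p₀ * f 0 + (1 - p₀) * f 1 := by
  have hf (a : ℝ) : Integrable f (Measure.dirac a) := integrable_dirac enorm_lt_top
  rw [bernoulliOnReal, integral_add_measure ((hf 0).smul_measure ENNReal.ofReal_ne_top)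
    ((hf 1).smul_measure ENNReal.ofReal_ne_top), integral_smul_measure, integral_smul_measure,
    integral_dirac, integral_dirac, ENNReal.toReal_ofReal hp₀,
    ENNReal.toReal_ofReal (sub_nonneg.2 hp₁), smul_eq_mul, smul_eq_mul]

/-- for `X` Bernoulli (`P(X=0)=p₀`, `P(X=1)=1−p₀`), `G`
independent standard Gaussian, and `γ, τ > 0`,
`E[|prox_{γ|·|}(X + τG)|] = p₀·2τ∫_{γ/τ}^∞ (g − γ/τ) pG(g) dg
  + (1 − p₀)·τ(∫_{γ/τ−1/τ}^∞ (g − γ/τ + 1/τ) pG(g) dg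
      − ∫_{−∞}^{−γ/τ−1/τ} (g + γ/τ + 1/τ) pG(g) dg)`. -/
theorem stmt_13 (p₀ γ τ : ℝ) (hp₀ : 0 ≤ p₀) (hp₁ : p₀ ≤ 1) (hγ : 0 < γ) (hτ : 0 < τ) :
    (∫ x, ∫ g, |softThresh γ (x + τ * g)| ∂(gaussianReal 0 1) ∂(bernoulliOnReal p₀))
      = p₀ * (2 * τ * ∫ g in Set.Ioi (γ / τ), (g - γ / τ) * pG g)
        + (1 - p₀) * (τ *
            ((∫ g in Set.Ioi (γ / τ - 1 / τ), (g - γ / τ + 1 / τ) * pG g)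
              - ∫ g in Set.Iic (-(γ / τ) - 1 / τ), (g + γ / τ + 1 / τ) * pG g)) := by
  rw [integral_bernoulliOnReal hp₀ hp₁, integral_abs_softThresh hγ hτ,
    integral_abs_softThresh hγ hτ]
  simp only [zero_div, sub_zero, add_zero, integral_Iic_neg_add_mul_pG]
  ring
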